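/- arXiv:1409.8188 — 7 statements merged into one kernel-verified Lean document; each statement's English description precedes it below -/
import Mathlib

section
/- Let N be a natural number. Then for all indices γ, μ, ν in Fin n, the following identity holds in the polynomial ring k[X_1,…,X_n]: ∑_ρ (δ_ρ((𝒞^N)^γ_μ)) · 𝒞^ρ_ν − ∑_ρ C^γ_{νρ} · (𝒞^N)^ρ_μ = ∑_σ C^σ_{μν} · (𝒞^N)^γ_σ. (Here ∑_ρ C^γ_{νρ}(𝒞^N)^ρ_μ is the same as ∑_ρ (δ_ρ 𝒞^γ_ν)(𝒞^N)^ρ_μ, since δ_ρ 𝒞^γ_ν = C^γ_{νρ}.) -/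
/-- The entrywise Leibniz rule for a derivation applied to a product of matrices. -/
theorem Matrix.map_derivation_mul {k R ι : Type*} [CommRing k] [CommRing R] [Algebra k R]
    [Fintype ι] (D : Derivation k R R) (M P : Matrix ι ι R) :
    (M * P).map D = M.map D * P + M * P.map D := by
  ext i j
  simp only [Matrix.map_apply, Matrix.mul_apply, Matrix.add_apply, map_sum, Derivation.leibniz,
    smul_eq_mul, ← Finset.sum_add_distrib]
  exact Finset.sum_congr rfl fun _ _ => by ring

/-- If a derivation acts on a matrix as the commutator with `A`, then so it does on its powers. -/
theorem Matrix.map_derivation_pow_eq_commutator {k R ι : Type*} [CommRing k] [CommRing R]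
    [Algebra k R] [Fintype ι] [DecidableEq ι] (D : Derivation k R R) (A M : Matrix ι ι R)
    (h : M.map D = A * M - M * A) (N : ℕ) :
    (M ^ N).map D = A * M ^ N - M ^ N * A := by
  induction N with
  | zero =>
    ext i j
    by_cases hij : i = j <;> simp [hij]
  | succ N ih =>
    rw [pow_succ, Matrix.map_derivation_mul, ih, h]
    noncomm_ring

open Finset MvPolynomial

/-- The identity `(δ_ρ (𝒞^N)^γ_μ) 𝒞^ρ_ν − (δ_ρ 𝒞^γ_ν)(𝒞^N)^ρ_μ = C^σ_{μν}(𝒞^N)^γ_σ`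
(equation (A.3) of the paper), using `δ_ρ 𝒞^γ_ν = C^γ_{νρ}`. -/
theorem statement0 (k : Type*) [Field k] [CharZero k] (n : ℕ)
    (C : Fin n → Fin n → Fin n → k)
    (hanti : ∀ l μ ν, C l μ ν = - C l ν μ)
    (hjac : ∀ μ ν τ σ, ∑ ρ, (C ρ μ ν * C σ ρ τ + C ρ ν τ * C σ ρ μ + C ρ τ μ * C σ ρ ν) = 0)
    (𝒞 : Matrix (Fin n) (Fin n) (MvPolynomial (Fin n) k))
    (h𝒞 : ∀ α β, 𝒞 α β = ∑ g, MvPolynomial.C (C α β g) * X g)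
    (N : ℕ) (γ μ ν : Fin n) :
    ∑ ρ, (pderiv ρ ((𝒞 ^ N) γ μ)) * 𝒞 ρ ν - ∑ ρ, MvPolynomial.C (C γ ν ρ) * (𝒞 ^ N) ρ μ
      = ∑ σ, MvPolynomial.C (C σ μ ν) * (𝒞 ^ N) γ σ := by
  let D : Derivation k (MvPolynomial (Fin n) k) (MvPolynomial (Fin n) k) :=
    ∑ ρ, 𝒞 ρ ν • pderiv ρ
  have hD (f : MvPolynomial (Fin n) k) : D f = ∑ ρ, pderiv ρ f * 𝒞 ρ ν := by
    simp only [D, ← Derivation.coeFnAddMonoidHom_apply, map_sum, Finset.sum_apply]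
    exact sum_congr rfl fun _ _ => mul_comm _ _
  let A : Matrix (Fin n) (Fin n) (MvPolynomial (Fin n) k) :=
    Matrix.of fun α β => MvPolynomial.C (C α ν β)
  have hpd (ρ α β : Fin n) : pderiv ρ (𝒞 α β) = MvPolynomial.C (C α β ρ) := by
    simp [h𝒞, pderiv_X, Pi.single_apply]
  have hjac' (α β g : Fin n) : ∑ ρ, C α β ρ * C ρ ν g
      = ∑ ρ, C α ν ρ * C ρ β g - ∑ ρ, C α ρ g * C ρ ν β := by
    rw [← sub_eq_zero, ← sum_sub_distrib, ← sum_sub_distrib, ← neg_eq_zero, ← sum_neg_distrib,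
      ← hjac β ν g α]
    refine sum_congr rfl fun ρ _ => ?_
    rw [hanti α β ρ, hanti α ν ρ, hanti ρ ν β, hanti ρ β g]
    ring
  have hcomm : 𝒞.map D = A * 𝒞 - 𝒞 * A := by
    ext1 α β
    simp only [Matrix.map_apply, hD, hpd, Matrix.sub_apply, Matrix.mul_apply, A, Matrix.of_apply]
    simp only [h𝒞, mul_sum, sum_mul]
    rw [sum_comm, sum_comm (s := univ) (t := univ)
      (f := fun x i => MvPolynomial.C (C α ν x) * (MvPolynomial.C (C x β i) * X i)),
      sum_comm (s := univ) (t := univ)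
      (f := fun x i => MvPolynomial.C (C α x i) * X i * MvPolynomial.C (C x ν β)),
      ← sum_sub_distrib]
    refine sum_congr rfl fun g _ => ?_
    have := congrArg (fun c => MvPolynomial.C c * X g) (hjac' α β g)
    simp only [map_sub, map_sum, map_mul, sub_mul, sum_mul] at this
    convert this using 2
    · ring
    · exact sum_congr rfl fun _ _ => by ring
    · exact sum_congr rfl fun _ _ => by ring
  have key := congrFun₂ (Matrix.map_derivation_pow_eq_commutator D A 𝒞 hcomm N) γ μ
  simp only [Matrix.map_apply, hD, Matrix.sub_apply, Matrix.mul_apply, A, Matrix.of_apply] at key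
  rw [key, sub_sub_cancel_left, ← sum_neg_distrib]
  refine sum_congr rfl fun σ _ => ?_
  rw [hanti σ μ ν, map_neg]
  ring
end

section
/- Let K be a natural number. Then for all indices γ, μ, ν in Fin n, the following identity holds in the polynomial ring k[X_1,…,X_n]: ∑_{ρ,σ,λ} (𝒞^K)^ρ_μ · (C^σ_{νρ} C^γ_{λσ} − C^σ_{νλ} C^γ_{ρσ}) · X_λ = − ∑_σ C^γ_{νσ} · (𝒞^{K+1})^σ_μ. -/
open Finset MvPolynomial

/-- The key inductive step (from the Jacobi identity):
`∑_{ρ,σ,λ} (𝒞^K)^ρ_μ (C^σ_{νρ} C^γ_{λσ} − C^σ_{νλ} C^γ_{ρσ}) X_λ = − C^γ_{νσ}(𝒞^{K+1})^σ_μ`. -/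
theorem statement1 (k : Type*) [Field k] [CharZero k] (n : ℕ)
    (C : Fin n → Fin n → Fin n → k)
    (hanti : ∀ l μ ν, C l μ ν = - C l ν μ)
    (hjac : ∀ μ ν τ σ, ∑ ρ, (C ρ μ ν * C σ ρ τ + C ρ ν τ * C σ ρ μ + C ρ τ μ * C σ ρ ν) = 0)
    (𝒞 : Matrix (Fin n) (Fin n) (MvPolynomial (Fin n) k))
    (h𝒞 : ∀ α β, 𝒞 α β = ∑ g, MvPolynomial.C (C α β g) * X g)
    (K : ℕ) (γ μ ν : Fin n) :
    ∑ ρ, ∑ σ, ∑ l, (𝒞 ^ K) ρ μ *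
        MvPolynomial.C (C σ ν ρ * C γ l σ - C σ ν l * C γ ρ σ) * X l
      = - ∑ σ, MvPolynomial.C (C γ ν σ) * (𝒞 ^ (K + 1)) σ μ := by
  have contracted_jacobi : ∀ ρ l, ∑ σ, (C σ ν ρ * C γ l σ - C σ ν l * C γ ρ σ)
      = - ∑ σ, C γ ν σ * C σ ρ l := by
    intro ρ l
    rw [← add_eq_zero_iff_eq_neg, ← sum_add_distrib, ← neg_eq_zero, ← sum_neg_distrib,
      ← hjac ν ρ l γ]
    refine sum_congr rfl fun σ _ => ?_
    rw [hanti γ l σ, hanti γ ρ σ, hanti γ ν σ, hanti σ ν l]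
    ring
  have hR : ∑ σ, MvPolynomial.C (C γ ν σ) * (𝒞 ^ (K + 1)) σ μ
      = ∑ ρ, ∑ l, (𝒞 ^ K) ρ μ * MvPolynomial.C (∑ σ, C γ ν σ * C σ ρ l) * X l := by
    simp only [pow_succ', Matrix.mul_apply, h𝒞, map_sum, map_mul, mul_sum, sum_mul]
    rw [sum_comm]
    refine sum_congr rfl fun ρ _ => ?_
    rw [sum_comm]
    refine sum_congr rfl fun l _ => sum_congr rfl fun σ _ => ?_
    ring
  rw [hR, ← sum_neg_distrib]
  refine sum_congr rfl fun ρ _ => ?_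
  rw [sum_comm, ← sum_neg_distrib]
  refine sum_congr rfl fun l _ => ?_
  rw [← sum_mul, ← mul_sum, ← map_sum, contracted_jacobi, map_neg]
  ring
end

section
/- For every natural number N and all indices γ, μ, ν in Fin n, the following identity holds in the polynomial ring k[X_1,…,X_n]: ∑_{p+q=N+1} ∑_ρ [ ((−1)^p B_p/p!)·(B_q/q!) · δ_ρ((𝒞^p)^γ_μ) · (𝒞^q)^ρ_ν − (B_p/p!)·((−1)^q B_q/q!) · δ_ρ((𝒞^p)^γ_ν) · (𝒞^q)^ρ_μ ] = 0, where the outer sum is over pairs of natural numbers (p,q) with p+q = N+1. (This is the degree-N homogeneous component of the power-series identity (δ_ρ φ^γ_μ) φ̃^ρ_ν − (δ_ρ φ̃^γ_ν) φ^ρ_μ = 0, which expresses the commutation [x̂_μ, ŷ_ν] = 0 between the realizations x̂_μ = x_σ φ^σ_μ and ŷ_ν = x_ρ φ̃^ρ_ν in the completed Weyl algebra.) -/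
open Finset MvPolynomial

open scoped Matrix

/-- The Bernoulli generating functions `f = x / (1 - e^{-x})` and `g = x / (e^x - 1)` satisfy
`s (f(s + t) - f(s)) g(t) + t (g(s + t) - g(t)) f(s) = 0`. -/
theorem bernoulliPowerSeries_rescale_identity {R : Type*} [CommRing R] [IsDomain R] [Algebra ℚ R]
    {s t : R} (hs : s ≠ 0) (ht : t ≠ 0) (hst : s + t ≠ 0) :
    PowerSeries.C s * (PowerSeries.rescale (s + t) (bernoulli'PowerSeries R)
          - PowerSeries.rescale s (bernoulli'PowerSeries R)) *
        PowerSeries.rescale t (bernoulliPowerSeries R)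
      + PowerSeries.C t * (PowerSeries.rescale (s + t) (bernoulliPowerSeries R)
          - PowerSeries.rescale t (bernoulliPowerSeries R)) *
        PowerSeries.rescale s (bernoulli'PowerSeries R) = 0 := by
  have hne : ∀ a : R, a ≠ 0 → PowerSeries.rescale a (PowerSeries.exp R) - 1 ≠ 0 := by
    intro a ha h
    have := congrArg (PowerSeries.coeff 1) h
    simp [PowerSeries.coeff_rescale, PowerSeries.coeff_exp, PowerSeries.coeff_one] at this
    exact ha this
  have hF : ∀ a : R, PowerSeries.rescale a (bernoulli'PowerSeries R) *
      (PowerSeries.rescale a (PowerSeries.exp R) - 1) =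
      PowerSeries.C a * PowerSeries.X * PowerSeries.rescale a (PowerSeries.exp R) := by
    intro a
    simpa [PowerSeries.rescale_X] using congrArg (PowerSeries.rescale a)
      (bernoulli'PowerSeries_mul_exp_sub_one R)
  have hG : ∀ a : R, PowerSeries.rescale a (bernoulliPowerSeries R) *
      (PowerSeries.rescale a (PowerSeries.exp R) - 1) = PowerSeries.C a * PowerSeries.X := by
    intro a
    simpa [PowerSeries.rescale_X] using congrArg (PowerSeries.rescale a)
      (bernoulliPowerSeries_mul_exp_sub_one R)
  have hE := PowerSeries.exp_mul_exp_eq_exp_add s t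
  have h1 := hne s hs
  have h2 := hne t ht
  have h3 := hne _ hst
  have hFs := hF s
  have hFst := hF (s + t)
  have hGt := hG t
  have hGst := hG (s + t)
  rw [← hE] at hFst hGst h3
  rw [map_add] at hFst hGst
  generalize PowerSeries.rescale s (PowerSeries.exp R) = Es at *
  generalize PowerSeries.rescale t (PowerSeries.exp R) = Et at *
  generalize PowerSeries.rescale s (bernoulli'PowerSeries R) = Fs at *
  generalize PowerSeries.rescale (s + t) (bernoulli'PowerSeries R) = Fst at *
  generalize PowerSeries.rescale t (bernoulliPowerSeries R) = Gt at *
  generalize PowerSeries.rescale (s + t) (bernoulliPowerSeries R) = Gst at *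
  generalize (PowerSeries.C s : PowerSeries R) = cs at *
  generalize (PowerSeries.C t : PowerSeries R) = ct at *
  generalize (PowerSeries.X : PowerSeries R) = x at *
  refine (mul_eq_zero.1 (?_ : (Es - 1) * ((Et - 1) * ((Es * Et - 1) * _)) = 0)).resolve_left h1
    |> fun h => (mul_eq_zero.1 h).resolve_left h2 |> fun h => (mul_eq_zero.1 h).resolve_left h3
  linear_combination (cs * (Es - 1) * Gt * (Et - 1)) * hFst
    + (ct * (Et - 1) * Fs * (Es - 1)) * hGst
    + (ct * ((cs + ct) * x * (Et - 1)) - (cs + ct) * (Es * Et - 1) * (Gt * (Et - 1))) * hFs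
    + (cs * (Es - 1) * (cs + ct) * x * Es * Et - (cs + ct) * (Es * Et - 1) * cs * x * Es) * hGt

theorem algebraMap_bernoulli_sum_eq_zero {R : Type*} [CommRing R] [IsDomain R] [Algebra ℚ R]
    {s t : R} (hs : s ≠ 0) (ht : t ≠ 0) (hst : s + t ≠ 0) (N : ℕ) :
    ∑ pq ∈ antidiagonal N,
      (algebraMap ℚ R (bernoulli' pq.1 / pq.1.factorial * (bernoulli pq.2 / pq.2.factorial)) *
          ∑ i ∈ range pq.1, (s + t) ^ i * (s ^ (pq.1 - 1 - i) * t ^ pq.2)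
        + algebraMap ℚ R (bernoulli pq.1 / pq.1.factorial * (bernoulli' pq.2 / pq.2.factorial)) *
          ∑ i ∈ range pq.1, (s + t) ^ i * (s ^ pq.2 * t ^ (pq.1 - 1 - i))) = 0 := by
  have key := congrArg (PowerSeries.coeff N) (bernoulliPowerSeries_rescale_identity hs ht hst)
  rw [mul_assoc, mul_assoc, map_add, PowerSeries.coeff_C_mul, PowerSeries.coeff_C_mul,
    PowerSeries.coeff_mul, PowerSeries.coeff_mul, mul_sum, mul_sum, ← sum_add_distrib,
    map_zero] at key
  refine (mul_eq_zero.1 (?_ : (s * t) * _ = 0)).resolve_left (mul_ne_zero hs ht)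
  rw [mul_sum, ← key]
  refine sum_congr rfl fun pq _ => ?_
  have h1 := geom_sum₂_mul (s + t) s pq.1
  have h2 := geom_sum₂_mul (s + t) t pq.1
  simp only [← mul_assoc, mul_right_comm _ (s ^ pq.2), ← sum_mul]
  simp only [map_sub, PowerSeries.coeff_rescale, bernoulliPowerSeries, bernoulli'PowerSeries,
    PowerSeries.coeff_mk, map_mul]
  rw [add_sub_cancel_left] at h1
  rw [add_sub_cancel_right] at h2
  linear_combination
    (s * algebraMap ℚ R (bernoulli' pq.1 / pq.1.factorial) *
      algebraMap ℚ R (bernoulli pq.2 / pq.2.factorial) * t ^ pq.2) * h1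
    + (t * algebraMap ℚ R (bernoulli pq.1 / pq.1.factorial) *
      algebraMap ℚ R (bernoulli' pq.2 / pq.2.factorial) * s ^ pq.2) * h2

/-- If `A` is a derivation of a bilinear product `br`, an `S`-linear map out of the polynomials in
two variables intertwines multiplication by `X 0 + X 1` with `A` and sends `X 0 ^ a * X 1 ^ b` to
`br (A ^ a u) (A ^ b w)`. -/
theorem exists_linearMap_intertwining {S V : Type*} [CommRing S] [AddCommGroup V] [Module S V]
    (br : V →ₗ[S] V →ₗ[S] V) (A : Module.End S V)
    (hA : ∀ a b, A (br a b) = br (A a) b + br a (A b)) (u w : V) :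
    ∃ Φ : MvPolynomial (Fin 2) S →ₗ[S] V, ∀ i a b,
      Φ ((X 0 + X 1) ^ i * (X 0 ^ a * X 1 ^ b)) = (A ^ i) (br ((A ^ a) u) ((A ^ b) w)) := by
  let Φ := (basisMonomials (Fin 2) S).constr S fun m => br ((A ^ m 0) u) ((A ^ m 1) w)
  have hΦ : ∀ m, Φ (monomial m 1) = br ((A ^ m 0) u) ((A ^ m 1) w) := fun m => by
    simpa using (basisMonomials (Fin 2) S).constr_basis S
      (fun m => br ((A ^ m 0) u) ((A ^ m 1) w)) m
  have hmul : ∀ P, Φ ((X 0 + X 1) * P) = A (Φ P) := by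
    have : Φ ∘ₗ LinearMap.mulLeft S (X 0 + X 1) = A ∘ₗ Φ := by
      refine (basisMonomials (Fin 2) S).ext fun m => ?_
      simp only [coe_basisMonomials, LinearMap.comp_apply, LinearMap.mulLeft_apply, add_mul,
        map_add, X, monomial_mul, one_mul, hΦ, hA]
      simp [pow_add, Module.End.mul_apply]
    exact fun P => LinearMap.congr_fun this P
  refine ⟨Φ, fun i a b => ?_⟩
  induction i with
  | zero =>
    have : (X 0 ^ a * X 1 ^ b : MvPolynomial (Fin 2) S) =
        monomial (Finsupp.single 0 a + Finsupp.single 1 b) 1 := by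
      simp [X_pow_eq_monomial, monomial_mul]
    simp [this, hΦ]
  | succ i ih => rw [pow_succ', mul_assoc, hmul, ih, pow_succ', Module.End.mul_apply]

theorem bernoulli_sum_derivation_eq_zero {S V : Type*} [CommRing S] [IsDomain S] [Algebra ℚ S]
    [AddCommGroup V] [Module S V] (br : V →ₗ[S] V →ₗ[S] V) (A : Module.End S V)
    (hA : ∀ a b, A (br a b) = br (A a) b + br a (A b)) (u w : V) (N : ℕ) :
    ∑ pq ∈ antidiagonal N,
      (algebraMap ℚ S (bernoulli' pq.1 / pq.1.factorial * (bernoulli pq.2 / pq.2.factorial)) •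
          ∑ i ∈ range pq.1, (A ^ i) (br ((A ^ (pq.1 - 1 - i)) u) ((A ^ pq.2) w))
        + algebraMap ℚ S (bernoulli pq.1 / pq.1.factorial * (bernoulli' pq.2 / pq.2.factorial)) •
          ∑ i ∈ range pq.1, (A ^ i) (br ((A ^ pq.2) u) ((A ^ (pq.1 - 1 - i)) w))) = 0 := by
  obtain ⟨Φ, hΦ⟩ := exists_linearMap_intertwining br A hA u w
  have hst : (X 0 + X 1 : MvPolynomial (Fin 2) S) ≠ 0 := fun h => by
    simpa using congrArg (MvPolynomial.eval ![(1 : S), 0]) h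
  have key := congrArg Φ (algebraMap_bernoulli_sum_eq_zero (X_ne_zero (R := S) (0 : Fin 2))
    (X_ne_zero (R := S) (1 : Fin 2)) hst N)
  simpa only [map_sum, map_add, IsScalarTower.algebraMap_apply ℚ S (MvPolynomial (Fin 2) S),
    ← Algebra.smul_def, map_smul, hΦ, map_zero] using key

theorem Matrix.map_derivation_pow {k S ι : Type*} [CommRing k] [CommRing S] [Algebra k S]
    [Fintype ι] [DecidableEq ι] (D : Derivation k S S) (M : Matrix ι ι S) (p : ℕ) :
    (M ^ p).map D = ∑ i ∈ range p, M ^ i * M.map D * M ^ (p - 1 - i) := by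
  induction p with
  | zero => ext i j; by_cases h : i = j <;> simp [h]
  | succ p ih =>
    have hmul : (M * M ^ p).map D = M.map D * M ^ p + M * (M ^ p).map D := by
      ext i j
      simp only [Matrix.map_apply, Matrix.mul_apply, map_sum, Derivation.leibniz, smul_eq_mul,
        Matrix.add_apply, ← sum_add_distrib]
      exact sum_congr rfl fun _ _ => by ring
    rw [pow_succ', hmul, ih, sum_range_succ', mul_sum, add_comm]
    congr 1
    · refine sum_congr rfl fun i _ => ?_
      rw [pow_succ', show p + 1 - 1 - (i + 1) = p - 1 - i by omega]
      simp only [mul_assoc]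
    · simp

/-- The `S`-bilinear product on `ι → S` with structure constants `c`. -/
def structureBracket {S ι : Type*} [CommRing S] [Fintype ι] (c : ι → ι → ι → S) :
    (ι → S) →ₗ[S] (ι → S) →ₗ[S] (ι → S) :=
  LinearMap.mk₂ S (fun a b l => ∑ m, ∑ n, c l m n * (a m * b n))
    (fun a a' b => by ext l; simp [add_mul, mul_add, sum_add_distrib])
    (fun r a b => by
      ext l; simp only [Pi.smul_apply, smul_eq_mul, mul_sum]
      exact sum_congr rfl fun _ _ => sum_congr rfl fun _ _ => by ring)
    (fun a b b' => by ext l; simp [mul_add, sum_add_distrib])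
    (fun r a b => by
      ext l; simp only [Pi.smul_apply, smul_eq_mul, mul_sum]
      exact sum_congr rfl fun _ _ => sum_congr rfl fun _ _ => by ring)

theorem structureBracket_apply {S ι : Type*} [CommRing S] [Fintype ι] (c : ι → ι → ι → S)
    (a b : ι → S) (l : ι) :
    structureBracket c a b l = ∑ m, ∑ n, c l m n * (a m * b n) := rfl

theorem structureBracket_antisymm {S ι : Type*} [CommRing S] [Fintype ι] {c : ι → ι → ι → S}
    (hanti : ∀ l m n, c l m n = -c l n m) (a b : ι → S) :
    structureBracket c a b = -structureBracket c b a := by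
  ext l
  rw [Pi.neg_apply, structureBracket_apply, structureBracket_apply, sum_comm, ← sum_neg_distrib]
  refine sum_congr rfl fun m _ => ?_
  rw [← sum_neg_distrib]
  exact sum_congr rfl fun n _ => by rw [hanti]; ring

theorem structureBracket_jacobi {S ι : Type*} [CommRing S] [Fintype ι] {c : ι → ι → ι → S}
    (hjac : ∀ m n t l, ∑ r, (c r m n * c l r t + c r n t * c l r m + c r t m * c l r n) = 0)
    (x y z : ι → S) :
    structureBracket c (structureBracket c x y) z + structureBracket c (structureBracket c y z) x
      + structureBracket c (structureBracket c z x) y = 0 := by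
  ext l
  have expand : ∀ x y z : ι → S, structureBracket c (structureBracket c x y) z l =
      ∑ m, ∑ n, ∑ t, (∑ r, c r m n * c l r t) * (x m * y n * z t) := by
    intro x y z
    simp only [structureBracket_apply, mul_sum, sum_mul]
    calc _ = ∑ r, ∑ m, ∑ n, ∑ t, c l r t * (c r m n * (x m * y n) * z t) :=
          sum_congr rfl fun r _ => sum_comm.trans (sum_congr rfl fun m _ => sum_comm)
      _ = ∑ m, ∑ n, ∑ r, ∑ t, c l r t * (c r m n * (x m * y n) * z t) :=
          sum_comm.trans (sum_congr rfl fun m _ => sum_comm)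
      _ = _ := sum_congr rfl fun m _ => sum_congr rfl fun n _ => sum_comm.trans <|
          sum_congr rfl fun t _ => sum_congr rfl fun r _ => by ring
  have h2 := (expand y z x).trans
    ((sum_congr rfl fun n _ => sum_comm).trans sum_comm)
  have h3 := (expand z x y).trans (sum_comm.trans (sum_congr rfl fun m _ => sum_comm))
  rw [Pi.add_apply, Pi.add_apply, expand x y z, h2, h3]
  simp only [← sum_add_distrib, Pi.zero_apply]
  refine sum_eq_zero fun m _ => sum_eq_zero fun n _ => sum_eq_zero fun t _ => ?_
  have h := hjac m n t l
  simp only [sum_add_distrib] at h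
  linear_combination (x m * y n * z t) * h

theorem structureBracket_leibniz {S ι : Type*} [CommRing S] [Fintype ι] {c : ι → ι → ι → S}
    (hanti : ∀ l m n, c l m n = -c l n m)
    (hjac : ∀ m n t l, ∑ r, (c r m n * c l r t + c r n t * c l r m + c r t m * c l r n) = 0)
    (x y z : ι → S) :
    structureBracket c (structureBracket c x y) z =
      structureBracket c (structureBracket c x z) y
        + structureBracket c x (structureBracket c y z) := by
  have h := structureBracket_jacobi hjac x y z
  rw [structureBracket_antisymm hanti z x, map_neg, LinearMap.neg_apply,
    structureBracket_antisymm hanti (structureBracket c y z) x] at h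
  linear_combination (exp := 1) h

/-- The directional derivative of the entries of a power of a matrix `M` whose derivatives are
given by a bilinear product. -/
theorem sum_pderiv_pow_mul {k ι : Type*} [CommRing k] [Fintype ι] [DecidableEq ι]
    (br : (ι → MvPolynomial ι k) →ₗ[MvPolynomial ι k] (ι → MvPolynomial ι k) →ₗ[MvPolynomial ι k]
      (ι → MvPolynomial ι k))
    (M : Matrix ι ι (MvPolynomial ι k))
    (hM : ∀ a v l, ∑ β, (∑ ρ, pderiv ρ (M l β) * v ρ) * a β = br a v l)
    (p : ℕ) (v : ι → MvPolynomial ι k) (l m : ι) :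
    ∑ ρ, pderiv ρ ((M ^ p) l m) * v ρ =
      (∑ i ∈ range p, (M.toLin' ^ i) (br ((M.toLin' ^ (p - 1 - i)) (Pi.single m 1)) v)) l := by
  let D : Derivation k (MvPolynomial ι k) (MvPolynomial ι k) := ∑ ρ, v ρ • pderiv ρ
  have hD : ∀ f, D f = ∑ ρ, pderiv ρ f * v ρ := fun f => by
    have h : (D : MvPolynomial ι k → _) = ∑ ρ, ⇑(v ρ • pderiv ρ) :=
      map_sum Derivation.coeFnAddMonoidHom _ _
    simp [h, mul_comm]
  have hMD : ∀ a, M.map D *ᵥ a = br a v := fun a => by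
    ext1 l
    simp only [← hM, Matrix.mulVec, dotProduct, Matrix.map_apply, hD]
  have hentry : ∀ P : Matrix ι ι (MvPolynomial ι k), P l m = (P *ᵥ Pi.single m 1) l := by simp
  have key : ∑ ρ, pderiv ρ ((M ^ p) l m) * v ρ = (M ^ p).map D l m := by
    rw [Matrix.map_apply, hD]
  rw [key, hentry ((M ^ p).map D), Matrix.map_derivation_pow, Matrix.sum_mulVec]
  simp only [← Matrix.toLin'_pow, Matrix.toLin'_apply, ← hMD, Matrix.mulVec_mulVec, mul_assoc]

/-- Degree-`N` homogeneous component of `(δ_ρ φ^γ_μ) φ̃^ρ_ν − (δ_ρ φ̃^γ_ν) φ^ρ_μ = 0`,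
where `φ = ∑_p ((−1)^p B_p/p!) 𝒞^p` and `φ̃ = ∑_p (B_p/p!) 𝒞^p`. -/
theorem statement2 (k : Type*) [Field k] [CharZero k] (n : ℕ)
    (C : Fin n → Fin n → Fin n → k)
    (hanti : ∀ l μ ν, C l μ ν = - C l ν μ)
    (hjac : ∀ μ ν τ σ, ∑ ρ, (C ρ μ ν * C σ ρ τ + C ρ ν τ * C σ ρ μ + C ρ τ μ * C σ ρ ν) = 0)
    (𝒞 : Matrix (Fin n) (Fin n) (MvPolynomial (Fin n) k))
    (h𝒞 : ∀ α β, 𝒞 α β = ∑ g, MvPolynomial.C (C α β g) * X g)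
    (N : ℕ) (γ μ ν : Fin n) :
    ∑ pq ∈ antidiagonal (N + 1), ∑ ρ,
        (MvPolynomial.C ((((-1) ^ pq.1 * bernoulli pq.1 / pq.1.factorial) *
              (bernoulli pq.2 / pq.2.factorial) : ℚ) : k) *
            pderiv ρ ((𝒞 ^ pq.1) γ μ) * (𝒞 ^ pq.2) ρ ν
          - MvPolynomial.C (((bernoulli pq.1 / pq.1.factorial) *
              ((-1) ^ pq.2 * bernoulli pq.2 / pq.2.factorial) : ℚ) : k) *
            pderiv ρ ((𝒞 ^ pq.1) γ ν) * (𝒞 ^ pq.2) ρ μ)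
      = 0 := by
  have hanti' : ∀ l m n', (MvPolynomial.C (C l m n') : MvPolynomial (Fin n) k) =
      -MvPolynomial.C (C l n' m) := fun l m n' => by rw [hanti, map_neg]
  have hjac' : ∀ m n' t l, ∑ r, ((MvPolynomial.C (C r m n') : MvPolynomial (Fin n) k) *
      MvPolynomial.C (C l r t) + MvPolynomial.C (C r n' t) * MvPolynomial.C (C l r m) +
      MvPolynomial.C (C r t m) * MvPolynomial.C (C l r n')) = 0 := fun m n' t l => by
    simpa using congrArg (MvPolynomial.C (σ := Fin n)) (hjac m n' t l)
  set br := structureBracket fun l m n' => (MvPolynomial.C (C l m n') : MvPolynomial (Fin n) k)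
    with hbr
  have hbr_X : ∀ a, 𝒞.toLin' a = br a X := fun a => by
    ext1 l
    simp only [Matrix.toLin'_apply, Matrix.mulVec, dotProduct, h𝒞, hbr, structureBracket_apply,
      sum_mul]
    exact sum_congr rfl fun _ _ => sum_congr rfl fun _ _ => by ring
  have hleib : ∀ a b, 𝒞.toLin' (br a b) = br (𝒞.toLin' a) b + br a (𝒞.toLin' b) := fun a b => by
    rw [hbr_X, hbr_X, hbr_X]
    exact structureBracket_leibniz hanti' hjac' a b X
  have hderiv : ∀ a v l, ∑ β, (∑ ρ, pderiv ρ (𝒞 l β) * v ρ) * a β = br a v l := fun a v l => by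
    simp only [h𝒞, hbr, structureBracket_apply, map_sum, pderiv_C_mul, pderiv_X, sum_mul]
    refine sum_congr rfl fun β _ => sum_congr rfl fun ρ _ => ?_
    simp only [Pi.single_apply, mul_ite, mul_one, mul_zero, ite_mul, zero_mul, sum_ite_eq',
      mem_univ, if_true]
    ring
  have hcol : ∀ q ν, (fun ρ => (𝒞 ^ q) ρ ν) = (𝒞.toLin' ^ q) (Pi.single ν 1) := fun q ν => by
    rw [← Matrix.toLin'_pow, Matrix.toLin'_apply, Matrix.mulVec_single_one]
    rfl
  have hterm : ∀ p q μ ν, ∑ ρ, pderiv ρ ((𝒞 ^ p) γ μ) * (𝒞 ^ q) ρ ν =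
      ∑ i ∈ range p, (𝒞.toLin' ^ i) (br ((𝒞.toLin' ^ (p - 1 - i)) (Pi.single μ 1))
        ((𝒞.toLin' ^ q) (Pi.single ν 1))) γ := fun p q μ ν => by
    rw [← hcol q ν, sum_pderiv_pow_mul br 𝒞 hderiv p (fun ρ => (𝒞 ^ q) ρ ν), Finset.sum_apply]
  have key := congrFun (bernoulli_sum_derivation_eq_zero br 𝒞.toLin' hleib
    (Pi.single μ 1) (Pi.single ν 1) (N + 1)) γ
  rw [Finset.sum_apply] at key
  refine Eq.trans (sum_congr rfl fun pq _ => ?_) key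
  have hcast : ∀ r : ℚ, algebraMap ℚ (MvPolynomial (Fin n) k) r = MvPolynomial.C (r : k) :=
    fun r => by rw [IsScalarTower.algebraMap_apply ℚ k, eq_ratCast, algebraMap_eq]
  simp only [sum_sub_distrib, mul_assoc, ← mul_sum, hterm, Pi.add_apply, Pi.smul_apply,
    Finset.sum_apply, smul_eq_mul, hcast, bernoulli'_eq_bernoulli]
  rw [sub_eq_add_neg, ← mul_neg, ← sum_neg_distrib]
  congr 2
  refine sum_congr rfl fun i _ => ?_
  rw [structureBracket_antisymm hanti', map_neg, Pi.neg_apply, neg_neg]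
end

section
/- For every natural number N and all indices λ, μ, ν in Fin n, the following identity holds in the polynomial ring k[X_1,…,X_n]: ∑_τ C^τ_{μν} · (𝒞^N)^λ_τ = ∑_{p+q=N} (N choose p) · ∑_{ρ,σ} C^λ_{ρσ} · (𝒞^p)^ρ_μ · (𝒞^q)^σ_ν, where the outer sum on the right is over pairs of natural numbers (p,q) with p+q = N. (This is N! times the degree-N homogeneous component of the matrix power-series identity C^τ_{μν} 𝒪^λ_τ = C^λ_{ρσ} 𝒪^ρ_μ 𝒪^σ_ν with 𝒪 = e^𝒞, which is identity (13) of Theorem 2.2.) -/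
open Finset MvPolynomial

open scoped Kronecker in
/-- Leibniz rule for powers: if `D` intertwines `B` with `D ⊗ₖ 1 + 1 ⊗ₖ D`, then `D ^ N * B` expands
binomially. -/
theorem Matrix.pow_mul_eq_mul_sum_kronecker {R ι : Type*} [CommRing R] [Fintype ι] [DecidableEq ι]
    (D : Matrix ι ι R) (B : Matrix ι (ι × ι) R) (h : D * B = B * (D ⊗ₖ 1 + 1 ⊗ₖ D)) (N : ℕ) :
    D ^ N * B =
      ∑ pq ∈ antidiagonal N, N.choose pq.1 • (B * ((D ^ pq.1) ⊗ₖ (D ^ pq.2))) := by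
  have hcomm : Commute (D ⊗ₖ (1 : Matrix ι ι R)) ((1 : Matrix ι ι R) ⊗ₖ D) := by
    simp [Commute, SemiconjBy, ← Matrix.mul_kronecker_mul]
  have hleft (p : ℕ) : (D ⊗ₖ (1 : Matrix ι ι R)) ^ p = (D ^ p) ⊗ₖ 1 := by
    induction p with
    | zero => simp
    | succ p ih => rw [pow_succ, ih, ← Matrix.mul_kronecker_mul, one_mul, pow_succ]
  have hright (p : ℕ) : ((1 : Matrix ι ι R) ⊗ₖ D) ^ p = 1 ⊗ₖ (D ^ p) := by
    induction p with
    | zero => simp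
    | succ p ih => rw [pow_succ, ih, ← Matrix.mul_kronecker_mul, one_mul, pow_succ]
  have hpow : D ^ N * B = B * (D ⊗ₖ 1 + 1 ⊗ₖ D) ^ N := by
    induction N with
    | zero => simp
    | succ N ih => rw [pow_succ, Matrix.mul_assoc, h, ← Matrix.mul_assoc, ih, Matrix.mul_assoc,
        pow_succ]
  rw [hpow, hcomm.add_pow', Matrix.mul_sum]
  simp only [Matrix.mul_smul, hleft, hright, ← Matrix.mul_kronecker_mul, one_mul, mul_one]

/-- `N!` times the degree-`N` homogeneous component of the identity
`C^τ_{μν} 𝒪^λ_τ = C^λ_{ρσ} 𝒪^ρ_μ 𝒪^σ_ν` with `𝒪 = e^𝒞` (identity (13) of Theorem 2.2). -/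
theorem statement5 (k : Type*) [Field k] [CharZero k] (n : ℕ)
    (C : Fin n → Fin n → Fin n → k)
    (hanti : ∀ l μ ν, C l μ ν = - C l ν μ)
    (hjac : ∀ μ ν τ σ, ∑ ρ, (C ρ μ ν * C σ ρ τ + C ρ ν τ * C σ ρ μ + C ρ τ μ * C σ ρ ν) = 0)
    (𝒞 : Matrix (Fin n) (Fin n) (MvPolynomial (Fin n) k))
    (h𝒞 : ∀ α β, 𝒞 α β = ∑ g, MvPolynomial.C (C α β g) * X g)
    (N : ℕ) (l μ ν : Fin n) :
    ∑ τ, MvPolynomial.C (C τ μ ν) * (𝒞 ^ N) l τ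
      = ∑ pq ∈ antidiagonal N, (N.choose pq.1 : MvPolynomial (Fin n) k) *
          ∑ ρ, ∑ σ, MvPolynomial.C (C l ρ σ) * (𝒞 ^ pq.1) ρ μ * (𝒞 ^ pq.2) σ ν := by
  have hleib (l μ ν g : Fin n) : ∑ τ, C l τ g * C τ μ ν
      = ∑ τ, (C l τ ν * C τ μ g + C l μ τ * C τ ν g) := by
    rw [← sub_eq_zero, ← sum_sub_distrib, ← hjac μ ν g l]
    refine sum_congr rfl fun τ _ => ?_
    rw [hanti l τ μ, hanti τ g μ]
    ring
  let B : Matrix (Fin n) (Fin n × Fin n) (MvPolynomial (Fin n) k) :=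
    Matrix.of fun l p => MvPolynomial.C (C l p.1 p.2)
  have hB : 𝒞 * B = B * (Matrix.kronecker 𝒞 1 + Matrix.kronecker 1 𝒞) := by
    ext1 l ⟨μ, ν⟩
    have hsum : ∑ τ, 𝒞 l τ * MvPolynomial.C (C τ μ ν)
        = ∑ τ, (MvPolynomial.C (C l τ ν) * 𝒞 τ μ + MvPolynomial.C (C l μ τ) * 𝒞 τ ν) := by
      simp only [h𝒞, mul_sum, sum_mul, ← sum_add_distrib]
      refine sum_comm.trans (Eq.trans ?_ sum_comm)
      refine sum_congr rfl fun g _ => ?_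
      have := congrArg (fun a => MvPolynomial.C a * (X g : MvPolynomial (Fin n) k)) (hleib l μ ν g)
      simp only [map_sum, map_add, map_mul, sum_mul] at this
      convert this using 2 <;> ring
    simpa [B, Matrix.mul_apply, Fintype.sum_prod_type, Matrix.one_apply, mul_add,
      sum_add_distrib] using hsum
  have hmain := congrFun (congrFun (𝒞.pow_mul_eq_mul_sum_kronecker B hB N) l) (μ, ν)
  rw [Matrix.sum_apply] at hmain
  simp only [Matrix.smul_apply, nsmul_eq_mul, Matrix.mul_apply, Fintype.sum_prod_type,
    Matrix.kroneckerMap_apply, B, Matrix.of_apply, ← mul_assoc] at hmain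
  simpa only [mul_comm] using hmain
end

section
/- For every natural number N and all indices λ, μ, ν in Fin n, the following identity holds in the polynomial ring k[X_1,…,X_n]: ∑_{p+q=N+1} (1/p!)·(B_q/q!) · ∑_ρ δ_ρ((𝒞^p)^λ_μ) · (𝒞^q)^ρ_ν = (1/N!) · ∑_ρ C^λ_{ρν} · (𝒞^N)^ρ_μ, where the outer sum is over pairs of natural numbers (p,q) with p+q = N+1. (This is the degree-N homogeneous component of the power-series identity (δ_ρ 𝒪^λ_μ) φ̃^ρ_ν = C^λ_{ρν} 𝒪^ρ_μ, which expresses the commutator identity [𝒪^λ_μ, ŷ_ν] = C^λ_{ρν} 𝒪^ρ_μ of Theorem 2.2, equation (9), in the realization ŷ_ν = x_ρ φ̃^ρ_ν.) -/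
open Finset MvPolynomial

/-- The coefficient form of `u / (e^u - 1) * (e^{at} - e^{bt}) = u * e^{bt}`, where
`u = (a - b) * t`. -/
lemma sum_bernoulli_mul_pow_sub_pow {T : Type*} [CommRing T] [Algebra ℚ T] (a b : T) (N : ℕ) :
    ∑ pq ∈ antidiagonal (N + 1),
        ((1 / pq.1.factorial) * (bernoulli pq.2 / pq.2.factorial) : ℚ) •
          ((a ^ pq.1 - b ^ pq.1) * (a - b) ^ pq.2)
      = (1 / N.factorial : ℚ) • ((a - b) * b ^ N) := by
  have h : (PowerSeries.rescale a (PowerSeries.exp T) - PowerSeries.rescale b (PowerSeries.exp T)) *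
      PowerSeries.rescale (a - b) (bernoulliPowerSeries T) =
      PowerSeries.rescale b (PowerSeries.exp T) * PowerSeries.rescale (a - b) PowerSeries.X := by
    rw [← bernoulliPowerSeries_mul_exp_sub_one T, map_mul, map_sub, map_one]
    have h2 := PowerSeries.exp_mul_exp_eq_exp_add (A := T) b (a - b)
    rw [add_sub_cancel] at h2
    rw [← h2]
    ring
  have h3 := congrArg (PowerSeries.coeff (N + 1)) h
  rw [PowerSeries.rescale_X, PowerSeries.coeff_mul, ← mul_assoc,
    PowerSeries.coeff_succ_mul_X, PowerSeries.coeff_mul_C] at h3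
  simp only [map_sub, PowerSeries.coeff_rescale, PowerSeries.coeff_exp, bernoulliPowerSeries,
    PowerSeries.coeff_mk] at h3
  calc _ = _ := Finset.sum_congr rfl fun pq _ => ?_
    _ = _ := h3
    _ = _ := ?_
  · rw [Algebra.smul_def, map_mul]; ring
  · rw [Algebra.smul_def]; ring

lemma sum_bernoulli_mul_geom_sum₂ {T : Type*} [CommRing T] [Algebra ℚ T] (a b : T) (N : ℕ) :
    ∑ pq ∈ antidiagonal (N + 1),
        ((1 / pq.1.factorial) * (bernoulli pq.2 / pq.2.factorial) : ℚ) •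
          ((∑ i ∈ range pq.1, a ^ i * b ^ (pq.1 - 1 - i)) * (a - b) ^ pq.2)
      = (1 / N.factorial : ℚ) • b ^ N := by
  have key : ∑ pq ∈ antidiagonal (N + 1),
        ((1 / pq.1.factorial) * (bernoulli pq.2 / pq.2.factorial) : ℚ) •
          ((∑ i ∈ range pq.1, (X 0 : MvPolynomial (Fin 2) ℚ) ^ i * X 1 ^ (pq.1 - 1 - i)) *
            (X 0 - X 1) ^ pq.2)
      = (1 / N.factorial : ℚ) • (X 1 : MvPolynomial (Fin 2) ℚ) ^ N := by
    have hne : (X 0 - X 1 : MvPolynomial (Fin 2) ℚ) ≠ 0 :=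
      sub_ne_zero.mpr fun h => by simpa using X_injective h
    apply mul_left_cancel₀ hne
    rw [mul_smul_comm, ← sum_bernoulli_mul_pow_sub_pow, mul_sum]
    refine sum_congr rfl fun pq _ => ?_
    rw [mul_smul_comm, ← mul_assoc, mul_comm (X 0 - X 1) (∑ i ∈ range pq.1, _),
      geom_sum₂_mul]
  simpa using congrArg (aeval ![a, b]) key

/-- The noncommutative form of `sum_bernoulli_mul_geom_sum₂`, for commuting elements. -/
lemma Commute.sum_bernoulli_mul_geom_sum₂ {E : Type*} [Ring E] [Algebra ℚ E] {a b : E}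
    (hab : Commute a b) (N : ℕ) :
    ∑ pq ∈ antidiagonal (N + 1),
        ((1 / pq.1.factorial) * (bernoulli pq.2 / pq.2.factorial) : ℚ) •
          ((∑ i ∈ range pq.1, a ^ i * b ^ (pq.1 - 1 - i)) * (a - b) ^ pq.2)
      = (1 / N.factorial : ℚ) • b ^ N := by
  have hcomm : ∀ x ∈ ({a, b} : Set E), ∀ y ∈ ({a, b} : Set E), x * y = y * x := by
    rintro x (rfl | rfl) y (rfl | rfl)
    exacts [rfl, hab, hab.symm, rfl]
  let : CommRing (Algebra.adjoin ℚ ({a, b} : Set E)) :=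
    { (inferInstance : Ring (Algebra.adjoin ℚ ({a, b} : Set E))) with
      mul_comm := (Algebra.isMulCommutative_adjoin ℚ hcomm).is_comm.comm }
  have h := _root_.sum_bernoulli_mul_geom_sum₂ (T := Algebra.adjoin ℚ ({a, b} : Set E))
    ⟨a, Algebra.subset_adjoin (by simp)⟩ ⟨b, Algebra.subset_adjoin (by simp)⟩ N
  simpa only [map_sum, map_smul, map_mul, map_pow, map_sub, Subalgebra.coe_val] using
    congrArg (Algebra.adjoin ℚ ({a, b} : Set E)).val h

/-- If `M (q + 1) = [a, M q]` for all `q`, the Bernoulli-weighted sum of the derivatives of powers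
of `a` in the directions `M q` collapses. -/
lemma sum_bernoulli_smul_sum_pow_mul_mul_pow {R : Type*} [Ring R] [Algebra ℚ R] (a : R)
    (M : ℕ → R) (hM : ∀ q, M (q + 1) = a * M q - M q * a) (N : ℕ) :
    ∑ pq ∈ antidiagonal (N + 1),
        ((1 / pq.1.factorial) * (bernoulli pq.2 / pq.2.factorial) : ℚ) •
          ∑ i ∈ range pq.1, a ^ i * M pq.2 * a ^ (pq.1 - 1 - i)
      = (1 / N.factorial : ℚ) • (M 0 * a ^ N) := by
  have hq : ∀ q, ((LinearMap.mulLeft ℚ a - LinearMap.mulRight ℚ a) ^ q) (M 0) = M q := by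
    intro q
    induction q with
    | zero => simp
    | succ q ih => rw [pow_succ', Module.End.mul_apply, ih, hM]; simp
  have h := LinearMap.congr_fun
    ((LinearMap.commute_mulLeft_right (R := ℚ) a a).sum_bernoulli_mul_geom_sum₂ N) (M 0)
  simpa [LinearMap.sum_apply, hq, LinearMap.pow_mulLeft, LinearMap.pow_mulRight, mul_assoc] using h

lemma Derivation.map_matrix_pow {S A n : Type*} [CommRing S] [CommRing A] [Algebra S A] [Fintype n]
    [DecidableEq n] (D : Derivation S A A) (m : Matrix n n A) (p : ℕ) :
    (m ^ p).map D = ∑ i ∈ range p, m ^ i * m.map D * m ^ (p - 1 - i) := by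
  have hmul (x y : Matrix n n A) : (x * y).map D = x * y.map D + x.map D * y := by
    ext i j
    simp [Matrix.mul_apply, sum_add_distrib, mul_comm]
  induction p with
  | zero =>
    ext i j
    by_cases h : i = j <;> simp [h]
  | succ p ih =>
    rw [pow_succ, hmul, ih, sum_range_succ, sum_mul, add_comm]
    congr 1
    · refine sum_congr rfl fun i hi => ?_
      rw [mul_assoc, ← pow_succ]
      congr 2
      have := mem_range.mp hi
      omega
    · simp

/-- The matrix of `e_β ↦ [e_β, ∑ g, w g • e_g]` for the bracket with structure constants `C`. -/
def structureMatrix {k ι A : Type*} [CommRing k] [Fintype ι] [CommRing A] [Algebra k A]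
    (C : ι → ι → ι → k) (w : ι → A) : Matrix ι ι A :=
  Matrix.of fun α β => ∑ g, algebraMap k A (C α β g) * w g

/-- The Jacobi identity in the form `M [v, x] = [M x, M v]` for `M = structureMatrix C`. -/
lemma structureMatrix_mulVec {k ι A : Type*} [CommRing k] [Fintype ι] [CommRing A] [Algebra k A]
    (C : ι → ι → ι → k)
    (hanti : ∀ l μ ν, C l μ ν = - C l ν μ)
    (hjac : ∀ μ ν τ σ, ∑ ρ, (C ρ μ ν * C σ ρ τ + C ρ ν τ * C σ ρ μ + C ρ τ μ * C σ ρ ν) = 0)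
    (x v : ι → A) :
    structureMatrix C ((structureMatrix C x).mulVec v) =
      structureMatrix C x * structureMatrix C v - structureMatrix C v * structureMatrix C x := by
  have hj (α β ρ γ : ι) : ∑ σ, algebraMap k A (C α β σ) * algebraMap k A (C σ ρ γ) =
      ∑ σ, algebraMap k A (C α σ γ) * algebraMap k A (C σ β ρ) -
        ∑ σ, algebraMap k A (C α σ ρ) * algebraMap k A (C σ β γ) := by
    simp only [← map_mul, ← map_sum, ← map_sub]
    congr 1
    rw [← sub_eq_zero, ← sum_sub_distrib, ← sum_sub_distrib, ← neg_eq_zero, ← sum_neg_distrib,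
      ← hjac β ρ γ α]
    refine sum_congr rfl fun σ _ => ?_
    rw [hanti α β σ, hanti σ γ β]
    ring
  ext α β
  have h1 : structureMatrix C ((structureMatrix C x).mulVec v) α β = ∑ γ, ∑ ρ, x γ * v ρ *
      ∑ σ, algebraMap k A (C α β σ) * algebraMap k A (C σ ρ γ) := by
    simp only [structureMatrix, Matrix.of_apply, Matrix.mulVec, dotProduct, mul_sum, sum_mul]
    rw [sum_comm_cycle]
    refine sum_congr rfl fun γ _ => sum_comm.trans ?_
    exact sum_congr rfl fun ρ _ => sum_congr rfl fun σ _ => by ring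
  have h2 : (structureMatrix C x * structureMatrix C v) α β = ∑ γ, ∑ ρ, x γ * v ρ *
      ∑ σ, algebraMap k A (C α σ γ) * algebraMap k A (C σ β ρ) := by
    simp only [structureMatrix, Matrix.mul_apply, Matrix.of_apply, sum_mul_sum]
    simp only [mul_sum]
    rw [sum_comm]
    refine sum_congr rfl fun γ _ => sum_comm.trans ?_
    exact sum_congr rfl fun ρ _ => sum_congr rfl fun σ _ => by ring
  have h3 : (structureMatrix C v * structureMatrix C x) α β = ∑ γ, ∑ ρ, x γ * v ρ *
      ∑ σ, algebraMap k A (C α σ ρ) * algebraMap k A (C σ β γ) := by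
    simp only [structureMatrix, Matrix.mul_apply, Matrix.of_apply, sum_mul_sum]
    simp only [mul_sum]
    rw [sum_comm_cycle]
    refine sum_congr rfl fun γ _ => sum_comm.trans ?_
    exact sum_congr rfl fun ρ _ => sum_congr rfl fun σ _ => by ring
  rw [Matrix.sub_apply, h1, h2, h3]
  simp only [← sum_sub_distrib, ← mul_sub, hj]

/-- Degree-`N` homogeneous component of `(δ_ρ 𝒪^λ_μ) φ̃^ρ_ν = C^λ_{ρν} 𝒪^ρ_μ`,
where `𝒪 = e^𝒞 = ∑_p (1/p!) 𝒞^p` and `φ̃ = ∑_p (B_p/p!) 𝒞^p`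
(the realization of identity (9) of Theorem 2.2). -/
theorem statement8 (k : Type*) [Field k] [CharZero k] (n : ℕ)
    (C : Fin n → Fin n → Fin n → k)
    (hanti : ∀ l μ ν, C l μ ν = - C l ν μ)
    (hjac : ∀ μ ν τ σ, ∑ ρ, (C ρ μ ν * C σ ρ τ + C ρ ν τ * C σ ρ μ + C ρ τ μ * C σ ρ ν) = 0)
    (𝒞 : Matrix (Fin n) (Fin n) (MvPolynomial (Fin n) k))
    (h𝒞 : ∀ α β, 𝒞 α β = ∑ g, MvPolynomial.C (C α β g) * X g)
    (N : ℕ) (l μ ν : Fin n) :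
    ∑ pq ∈ antidiagonal (N + 1),
        MvPolynomial.C (((1 / pq.1.factorial) * (bernoulli pq.2 / pq.2.factorial) : ℚ) : k) *
          ∑ ρ, pderiv ρ ((𝒞 ^ pq.1) l μ) * (𝒞 ^ pq.2) ρ ν
      = MvPolynomial.C ((1 / N.factorial : ℚ) : k) *
          ∑ ρ, MvPolynomial.C (C l ρ ν) * (𝒞 ^ N) ρ μ := by
  have had : 𝒞 = structureMatrix C X := Matrix.ext h𝒞
  have hM (q : ℕ) : structureMatrix C ((𝒞 ^ (q + 1)).col ν) =
      𝒞 * structureMatrix C ((𝒞 ^ q).col ν) - structureMatrix C ((𝒞 ^ q).col ν) * 𝒞 := by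
    rw [had, ← structureMatrix_mulVec C hanti hjac X, pow_succ']
    rfl
  have hD (p q : ℕ) : ∑ ρ, pderiv ρ ((𝒞 ^ p) l μ) * (𝒞 ^ q) ρ ν =
      (∑ i ∈ range p, 𝒞 ^ i * structureMatrix C ((𝒞 ^ q).col ν) * 𝒞 ^ (p - 1 - i)) l μ := by
    let D : Derivation k (MvPolynomial (Fin n) k) (MvPolynomial (Fin n) k) :=
      ∑ ρ, (𝒞 ^ q) ρ ν • pderiv ρ
    have hDapp (f) : D f = ∑ ρ, pderiv ρ f * (𝒞 ^ q) ρ ν := by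
      change Derivation.coeFnAddMonoidHom D f = _
      rw [map_sum, Finset.sum_apply]
      exact sum_congr rfl fun ρ _ => mul_comm _ _
    have hmap : 𝒞.map D = structureMatrix C ((𝒞 ^ q).col ν) := by
      ext1 α β
      have hX (g) : D (X g) = (𝒞 ^ q) g ν := by
        simp [hDapp, pderiv_X, Pi.single_apply]
      simp [h𝒞, structureMatrix, hX, MvPolynomial.C_mul']
    rw [← hmap, ← D.map_matrix_pow, Matrix.map_apply, hDapp]
  have h := congrFun (congrFun (sum_bernoulli_smul_sum_pow_mul_mul_pow 𝒞
    (fun q => structureMatrix C ((𝒞 ^ q).col ν)) hM N) l) μ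
  have hsmul (r : ℚ) (f : MvPolynomial (Fin n) k) : MvPolynomial.C (r : k) * f = r • f := by
    rw [MvPolynomial.C_mul', Rat.cast_smul_eq_qsmul]
  simp only [hsmul, hD]
  rw [Matrix.sum_apply] at h
  refine h.trans ?_
  rw [Matrix.smul_apply, Matrix.mul_apply]
  congr 1
  refine sum_congr rfl fun ρ _ => ?_
  simp [structureMatrix, Matrix.one_apply]
end

section
/- For every natural number N and all indices λ, μ, ν in Fin n, the following identity holds in the polynomial ring k[X_1,…,X_n]: ∑_{p+q=N+1} ((−1)^p/p!)·(B_q/q!) · ∑_ρ δ_ρ((𝒞^p)^λ_μ) · (𝒞^q)^ρ_ν = −((−1)^N/N!) · ∑_ρ C^ρ_{μν} · (𝒞^N)^λ_ρ, where the outer sum is over pairs of natural numbers (p,q) with p+q = N+1. (This is the degree-N homogeneous component of the power-series identity (δ_ρ (𝒪^{−1})^λ_μ) φ̃^ρ_ν = −C^ρ_{μν} (𝒪^{−1})^λ_ρ, which expresses the commutator identity [(𝒪^{−1})^λ_μ, ŷ_ν] = −C^ρ_{μν}(𝒪^{−1})^λ_ρ of Theorem 2.2, equation (12), in the realization ŷ_ν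 = x_ρ φ̃^ρ_ν.) -/
open Finset MvPolynomial

/-- Degree-`N + 1` coefficient of
`(e^{-x} - e^{-y}) (x - y) / (e^{x-y} - 1) = -(x - y) e^{-x}`. -/
theorem sum_antidiagonal_pow_sub_pow_mul_bernoulli {A : Type*} [CommRing A] [Algebra ℚ A]
    (x y : A) (N : ℕ) :
    ∑ pq ∈ antidiagonal (N + 1),
        ((-1) ^ pq.1 / pq.1.factorial * (bernoulli pq.2 / pq.2.factorial) : ℚ) •
          ((x ^ pq.1 - y ^ pq.1) * (x - y) ^ pq.2)
      = -(((-1) ^ N / N.factorial : ℚ) • (x ^ N * (x - y))) := by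
  have key : (PowerSeries.rescale (-x) (PowerSeries.exp A) -
        PowerSeries.rescale (-y) (PowerSeries.exp A)) *
        PowerSeries.rescale (x - y) (bernoulliPowerSeries A)
      = -(PowerSeries.rescale (-x) (PowerSeries.exp A) * PowerSeries.C (x - y))
          * PowerSeries.X := by
    have hB := congrArg (PowerSeries.rescale (x - y))
      (bernoulliPowerSeries_mul_exp_sub_one A)
    have hE := PowerSeries.exp_mul_exp_eq_exp_add (-x) (x - y)
    rw [map_mul, map_sub, map_one, PowerSeries.rescale_X] at hB
    rw [show -x + (x - y) = -y by ring] at hE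
    rw [← hE]
    linear_combination -(PowerSeries.rescale (-x) (PowerSeries.exp A)) * hB
  have hcoeff := congrArg (PowerSeries.coeff (N + 1)) key
  rw [PowerSeries.coeff_succ_mul_X, PowerSeries.coeff_mul, map_neg,
    PowerSeries.coeff_mul_C] at hcoeff
  have hneg : ∀ (z : A) (p : ℕ), (-z) ^ p = algebraMap ℚ A ((-1) ^ p) * z ^ p := by
    intro z p
    rw [neg_pow, map_pow, map_neg, map_one]
  convert hcoeff using 1
  · refine sum_congr rfl fun pq _ => ?_
    simp only [map_sub, PowerSeries.coeff_rescale, PowerSeries.coeff_exp, bernoulliPowerSeries,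
      PowerSeries.coeff_mk, hneg, Algebra.smul_def, div_eq_mul_inv, map_mul, one_mul]
    ring
  · simp only [PowerSeries.coeff_rescale, PowerSeries.coeff_exp, hneg, Algebra.smul_def,
      div_eq_mul_inv, map_mul, one_mul]
    ring

/-- The degree-`N` coefficient of
`((e^{-x} - e^{-y}) / (x - y)) (x - y) / (e^{x-y} - 1) = -e^{-x}`, in a domain. -/
theorem sum_antidiagonal_geom_sum₂_mul_bernoulli {A : Type*} [CommRing A] [IsDomain A]
    [Algebra ℚ A] {x y : A} (hxy : x - y ≠ 0) (N : ℕ) :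
    ∑ pq ∈ antidiagonal (N + 1),
        ((-1) ^ pq.1 / pq.1.factorial * (bernoulli pq.2 / pq.2.factorial) : ℚ) •
          ((∑ i ∈ range pq.1, x ^ i * y ^ (pq.1 - 1 - i)) * (x - y) ^ pq.2)
      = -(((-1) ^ N / N.factorial : ℚ) • x ^ N) := by
  apply mul_right_cancel₀ hxy
  rw [neg_mul, smul_mul_assoc, ← sum_antidiagonal_pow_sub_pow_mul_bernoulli, sum_mul]
  refine sum_congr rfl fun pq _ => ?_
  rw [smul_mul_assoc, mul_right_comm, (Commute.all x y).geom_sum₂_mul]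

open scoped Polynomial in
/-- The degree-`N` coefficient of
`((e^{-x} - e^{-y}) / (x - y)) (x - y) / (e^{x-y} - 1) = -e^{-x}`,
for commuting `x` and `y` in any `ℚ`-algebra. -/
theorem Commute.sum_antidiagonal_geom_sum₂_mul_bernoulli {S : Type*} [Ring S] [Algebra ℚ S]
    {x y : S} (h : Commute x y) (N : ℕ) :
    ∑ pq ∈ antidiagonal (N + 1),
        ((-1) ^ pq.1 / pq.1.factorial * (bernoulli pq.2 / pq.2.factorial) : ℚ) •
          ((∑ i ∈ range pq.1, x ^ i * y ^ (pq.1 - 1 - i)) * (x - y) ^ pq.2)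
      = -(((-1) ^ N / N.factorial : ℚ) • x ^ N) := by
  let u : ℚ[X][X] := Polynomial.C Polynomial.X
  let v : ℚ[X][X] := Polynomial.X
  have huv : u - v ≠ 0 := by
    rw [← neg_ne_zero, neg_sub]
    exact Polynomial.X_sub_C_ne_zero _
  have hpoly := _root_.sum_antidiagonal_geom_sum₂_mul_bernoulli huv N
  let f : ℚ[X][X] →+* S := Polynomial.eval₂RingHom' (Polynomial.aeval x).toRingHom y fun a =>
    Polynomial.induction_on' a
      (fun p q hp hq => by
        rw [map_add]
        exact hp.add_left hq)
      (fun m r => by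
        change Commute (Polynomial.aeval x (Polynomial.monomial m r)) y
        rw [Polynomial.aeval_monomial]
        exact (Algebra.commute_algebraMap_left r y).mul_left (h.pow_left m))
  have hu : f u = x := by simp [f, u]
  have hv : f v = y := by simp [f, v]
  simpa only [map_sum, map_rat_smul, map_mul, map_pow, map_sub, map_neg, hu, hv]
    using congrArg f hpoly

namespace Matrix

variable {ι R S : Type*} [Fintype ι]

theorem map_derivation_pow_s11 [DecidableEq ι] [CommRing R] [CommRing S] [Algebra R S]
    (d : Derivation R S S)
    (M : Matrix ι ι S) (p : ℕ) :
    (M ^ p).map d = ∑ i ∈ range p, M ^ i * M.map d * M ^ (p - 1 - i) := by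
  induction p with
  | zero =>
    ext a b
    by_cases hab : a = b <;> simp [hab]
  | succ p ih =>
    have hstep : (M ^ (p + 1)).map d = (M ^ p).map d * M + M ^ p * M.map d := by
      ext a b
      simp only [pow_succ, map_apply, mul_apply, add_apply, map_sum, Derivation.leibniz,
        smul_eq_mul, sum_add_distrib]
      rw [add_comm]
      simp only [mul_comm]
    rw [hstep, ih, sum_range_succ, sum_mul]
    congr 1
    · refine sum_congr rfl fun i hi => ?_
      have hi' : p + 1 - 1 - i = p - 1 - i + 1 := by
        have := mem_range.mp hi
        omega
      rw [hi', pow_succ, mul_assoc]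
    · simp

/-- The matrix of right bracketing `w ↦ [w, v]` for the structure constants `c`. -/
def rightBracket [CommRing S] (c : ι → ι → ι → S) (v : ι → S) : Matrix ι ι S :=
  of fun a b => ∑ g, c a b g * v g

variable [CommRing S] {c : ι → ι → ι → S}

theorem rightBracket_mulVec (hanti : ∀ l μ ν, c l μ ν = -c l ν μ)
    (hjac : ∀ μ ν τ σ, ∑ ρ, (c ρ μ ν * c σ ρ τ + c ρ ν τ * c σ ρ μ + c ρ τ μ * c σ ρ ν) = 0)
    (x v : ι → S) :
    rightBracket c (rightBracket c x *ᵥ v)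
      = rightBracket c x * rightBracket c v - rightBracket c v * rightBracket c x := by
  ext a b
  have hL : rightBracket c (rightBracket c x *ᵥ v) a b
      = ∑ s, ∑ g, (∑ r, c a b r * c r s g) * (v s * x g) := by
    simp only [rightBracket, of_apply, mulVec, dotProduct, mul_sum, sum_mul]
    rw [sum_comm]
    refine sum_congr rfl fun s _ => ?_
    rw [sum_comm]
    exact sum_congr rfl fun g _ => sum_congr rfl fun r _ => by ring
  have hR₁ : (rightBracket c x * rightBracket c v) a b
      = ∑ s, ∑ g, (∑ r, c a r g * c r b s) * (v s * x g) := by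
    simp only [rightBracket, of_apply, mul_apply, mul_sum, sum_mul]
    rw [sum_comm]
    refine sum_congr rfl fun s _ => ?_
    rw [sum_comm]
    exact sum_congr rfl fun g _ => sum_congr rfl fun r _ => by ring
  have hR₂ : (rightBracket c v * rightBracket c x) a b
      = ∑ s, ∑ g, (∑ r, c a r s * c r b g) * (v s * x g) := by
    simp only [rightBracket, of_apply, mul_apply, mul_sum, sum_mul]
    rw [sum_comm, sum_congr rfl fun _ _ => sum_comm, sum_comm]
    exact sum_congr rfl fun s _ => sum_congr rfl fun g _ => sum_congr rfl fun r _ => by ring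
  rw [sub_apply, hL, hR₁, hR₂, ← sum_sub_distrib]
  refine sum_congr rfl fun s _ => ?_
  rw [← sum_sub_distrib]
  refine sum_congr rfl fun g _ => ?_
  rw [← sub_mul, ← sum_sub_distrib]
  congr 1
  rw [← sub_eq_zero, ← sum_sub_distrib, ← neg_eq_zero, ← sum_neg_distrib, ← hjac s g b a]
  refine sum_congr rfl fun r _ => ?_
  rw [hanti a b r, hanti r b g]
  ring

theorem rightBracket_pow_mulVec [DecidableEq ι] (hanti : ∀ l μ ν, c l μ ν = -c l ν μ)
    (hjac : ∀ μ ν τ σ, ∑ ρ, (c ρ μ ν * c σ ρ τ + c ρ ν τ * c σ ρ μ + c ρ τ μ * c σ ρ ν) = 0)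
    [Algebra ℚ S] (x v : ι → S) (q : ℕ) :
    rightBracket c (rightBracket c x ^ q *ᵥ v)
      = ((LinearMap.mulLeft ℚ (rightBracket c x) - LinearMap.mulRight ℚ (rightBracket c x)) ^ q)
          (rightBracket c v) := by
  induction q with
  | zero => simp
  | succ q ih =>
    rw [pow_succ', ← mulVec_mulVec, rightBracket_mulVec hanti hjac, ih, pow_succ']
    rfl

end Matrix

/-- Degree-`N` homogeneous component of `(δ_ρ (𝒪^{−1})^λ_μ) φ̃^ρ_ν = −C^ρ_{μν} (𝒪^{−1})^λ_ρ`,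
where `𝒪^{−1} = e^{−𝒞} = ∑_p ((−1)^p/p!) 𝒞^p` and `φ̃ = ∑_p (B_p/p!) 𝒞^p`
(the realization of identity (12) of Theorem 2.2). -/
theorem statement11 (k : Type*) [Field k] [CharZero k] (n : ℕ)
    (C : Fin n → Fin n → Fin n → k)
    (hanti : ∀ l μ ν, C l μ ν = - C l ν μ)
    (hjac : ∀ μ ν τ σ, ∑ ρ, (C ρ μ ν * C σ ρ τ + C ρ ν τ * C σ ρ μ + C ρ τ μ * C σ ρ ν) = 0)
    (𝒞 : Matrix (Fin n) (Fin n) (MvPolynomial (Fin n) k))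
    (h𝒞 : ∀ α β, 𝒞 α β = ∑ g, MvPolynomial.C (C α β g) * X g)
    (N : ℕ) (l μ ν : Fin n) :
    ∑ pq ∈ antidiagonal (N + 1),
        MvPolynomial.C ((((-1) ^ pq.1 / pq.1.factorial) *
            (bernoulli pq.2 / pq.2.factorial) : ℚ) : k) *
          ∑ ρ, pderiv ρ ((𝒞 ^ pq.1) l μ) * (𝒞 ^ pq.2) ρ ν
      = - (MvPolynomial.C (((-1) ^ N / N.factorial : ℚ) : k) *
          ∑ ρ, MvPolynomial.C (C ρ μ ν) * (𝒞 ^ N) l ρ) := by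
  let c : Fin n → Fin n → Fin n → MvPolynomial (Fin n) k := fun a b g => MvPolynomial.C (C a b g)
  have hc : ∀ l μ ν, c l μ ν = -c l ν μ := fun l μ ν => by
    simp only [c]
    rw [hanti, map_neg]
  have hcjac : ∀ μ ν τ σ,
      ∑ ρ, (c ρ μ ν * c σ ρ τ + c ρ ν τ * c σ ρ μ + c ρ τ μ * c σ ρ ν) = 0 := fun μ ν τ σ => by
    simpa only [map_sum, map_add, map_mul, map_zero] using
      congrArg (MvPolynomial.C (σ := Fin n)) (hjac μ ν τ σ)
  have h𝒞c : 𝒞 = Matrix.rightBracket c X := by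
    ext1 a b
    exact h𝒞 a b
  let L := LinearMap.mulLeft ℚ 𝒞
  let R := LinearMap.mulRight ℚ 𝒞
  let A := Matrix.rightBracket c (Pi.single ν 1)
  have hA : ∀ a b, A a b = c a b ν := fun a b => by
    simp [A, Matrix.rightBracket, Pi.single_apply]
  have hderiv : ∀ p q, ∑ ρ, pderiv ρ ((𝒞 ^ p) l μ) * (𝒞 ^ q) ρ ν
      = ((∑ i ∈ range p, L ^ i * R ^ (p - 1 - i)) * (L - R) ^ q) A l μ := by
    intro p q
    let d : Derivation k (MvPolynomial (Fin n) k) (MvPolynomial (Fin n) k) :=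
      ∑ ρ, (𝒞 ^ q) ρ ν • pderiv ρ
    have hd : ∀ f, d f = ∑ ρ, pderiv ρ f * (𝒞 ^ q) ρ ν := fun f => by
      simp only [d, ← Derivation.coeFnAddMonoidHom_apply, map_sum, Finset.sum_apply]
      simp [Derivation.coeFnAddMonoidHom, mul_comm]
    have hd𝒞 : 𝒞.map d = ((L - R) ^ q) A := by
      have hpow := Matrix.rightBracket_pow_mulVec hc hcjac X (Pi.single ν 1) q
      rw [← h𝒞c] at hpow
      refine Eq.trans ?_ hpow
      ext1 a b
      simp [hd, h𝒞, Matrix.rightBracket, c, pderiv_X, Pi.single_apply]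
    have hmap := congrFun (congrFun (Matrix.map_derivation_pow_s11 d 𝒞 p) l) μ
    rw [Matrix.map_apply, hd, hd𝒞] at hmap
    rw [hmap, Module.End.mul_apply, LinearMap.sum_apply]
    simp only [Module.End.mul_apply, L, R, LinearMap.pow_mulLeft, LinearMap.pow_mulRight,
      LinearMap.mulLeft_apply, LinearMap.mulRight_apply, mul_assoc]
  have hC : ∀ (r : ℚ) (f : MvPolynomial (Fin n) k), MvPolynomial.C (r : k) * f = r • f :=
    fun r f => by
      rw [MvPolynomial.C_mul', Rat.cast_smul_eq_qsmul]
  have hmain := congrFun (congrFun (LinearMap.congr_fun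
    ((LinearMap.commute_mulLeft_right (R := ℚ) 𝒞 𝒞).sum_antidiagonal_geom_sum₂_mul_bernoulli N) A) l) μ
  simp only [hC, hderiv]
  simp only [LinearMap.sum_apply, Matrix.sum_apply, LinearMap.smul_apply, Matrix.smul_apply,
    LinearMap.neg_apply, Matrix.neg_apply] at hmain
  refine hmain.trans ?_
  rw [LinearMap.pow_mulLeft, LinearMap.mulLeft_apply, Matrix.mul_apply]
  simp only [hA, c, mul_comm]
end

section
/- For every natural number N ≥ 1 and every index μ in Fin n, the following identity holds in the polynomial ring k[X_1,…,X_n]: ∑_{p+q=N} ((−1)^p/p!)·((−1)^q B_q/q!) · ∑_{ρ,σ} δ_σ((𝒞^p)^ρ_μ) · (𝒞^q)^σ_ρ equals the constant polynomial −∑_λ C^λ_{μλ} when N = 1, and equals 0 when N ≥ 2; here the outer sum is over pairs of natural numbers (p,q) with p+q = N. (These are the homogeneous components of the power-series identity ∑_{ρ,σ} (δ_σ (e^{−𝒞})^ρ_μ) φ^σ_ρ = −∑_λ C^λ_{μλ}, which encodes the antipode formula S(x̂_μ) = ŷ_μ − C^λ_{μλ} of the Hopf algebroid antipode theorem, equation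 (40), via the realizations x̂_μ = x_σ φ^σ_μ, ŷ_μ = x_σ φ̃^σ_μ and the relation S(x̂_μ) = (𝒪^{−1})^ρ_μ x̂_ρ.) -/
open Finset MvPolynomial

/-- The matrix of `ad e_μ` in the basis with structure constants `c`. -/
def adMatrix {R ι : Type*} (c : ι → ι → ι → R) (μ : ι) : Matrix ι ι R :=
  Matrix.of fun α σ => c α μ σ

section StructureConstants

variable {R ι : Type*} [CommRing R] [Fintype ι] {c : ι → ι → ι → R}
  {x : ι → R} {A : Matrix ι ι R}

/-- If `A = -ad x`, then `ad (A e_β) = [A, ad e_β]`, by the Jacobi identity. -/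
theorem sum_smul_adMatrix (hanti : ∀ l μ ν, c l μ ν = - c l ν μ)
    (hjac : ∀ μ ν τ σ, ∑ ρ, (c ρ μ ν * c σ ρ τ + c ρ ν τ * c σ ρ μ + c ρ τ μ * c σ ρ ν) = 0)
    (hA : ∀ α β, A α β = ∑ g, c α β g * x g) (β : ι) :
    ∑ γ, A γ β • adMatrix c γ = A * adMatrix c β - adMatrix c β * A := by
  ext α σ
  have key : ∀ g, ∑ ρ, (c ρ β g * x g * c α ρ σ) =
      ∑ ρ, (c α ρ g * x g * c ρ β σ - c α β ρ * (c ρ σ g * x g)) := by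
    intro g
    rw [← sub_eq_zero, ← sum_sub_distrib, ← mul_zero (x g), ← hjac β g σ α, mul_sum]
    refine sum_congr rfl fun ρ _ => ?_
    rw [hanti ρ g σ, hanti α ρ β, hanti ρ σ β]
    ring
  simp only [Matrix.sum_apply, Matrix.smul_apply, smul_eq_mul, Matrix.sub_apply,
    Matrix.mul_apply, adMatrix, Matrix.of_apply, hA, sum_mul, mul_sum]
  rw [← sum_sub_distrib]
  simp only [← sum_sub_distrib]
  rw [sum_comm, sum_congr rfl fun g _ => key g, sum_comm]

variable [DecidableEq ι]

/-- `tr (A ^ m * ad (A e_β)) = 0` for `A = -ad x`. -/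
theorem vecMul_trace_pow_mul_adMatrix (hanti : ∀ l μ ν, c l μ ν = - c l ν μ)
    (hjac : ∀ μ ν τ σ, ∑ ρ, (c ρ μ ν * c σ ρ τ + c ρ ν τ * c σ ρ μ + c ρ τ μ * c σ ρ ν) = 0)
    (hA : ∀ α β, A α β = ∑ g, c α β g * x g) (m : ℕ) :
    Matrix.vecMul (fun γ => (A ^ m * adMatrix c γ).trace) A = 0 := by
  ext β
  calc ∑ γ, (A ^ m * adMatrix c γ).trace * A γ β
      = (A ^ m * ∑ γ, A γ β • adMatrix c γ).trace := by
        simp [Matrix.mul_sum, Matrix.trace_sum, mul_comm]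
    _ = 0 := by
        rw [sum_smul_adMatrix hanti hjac hA, mul_sub, Matrix.trace_sub, ← mul_assoc, ← mul_assoc,
          Matrix.trace_mul_comm _ A, ← mul_assoc, ← pow_succ, ← pow_succ', sub_self]

/-- If `A = -ad x` and `D σ A = -ad e_σ`, then contracting the derivatives of `A ^ (p + 1)` with
`A ^ q` leaves only the trace of `A ^ (p + q) * ad e_μ`. -/
theorem sum_derivation_pow_mul_pow {S : Type*} [CommRing S] [Algebra S R]
    (D : ι → Derivation S R R) (hanti : ∀ l μ ν, c l μ ν = - c l ν μ)
    (hjac : ∀ μ ν τ σ, ∑ ρ, (c ρ μ ν * c σ ρ τ + c ρ ν τ * c σ ρ μ + c ρ τ μ * c σ ρ ν) = 0)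
    (hA : ∀ α β, A α β = ∑ g, c α β g * x g) (hD : ∀ σ α β, D σ (A α β) = c α β σ)
    (p q : ℕ) (μ : ι) :
    ∑ ρ, ∑ σ, D σ ((A ^ (p + 1)) ρ μ) * (A ^ q) σ ρ = (A ^ (p + q) * adMatrix c μ).trace := by
  have step : ∀ (p : ℕ) (μ : ι), ∑ ρ, ∑ σ, D σ ((A ^ (p + 1)) ρ μ) * (A ^ q) σ ρ =
      Matrix.vecMul (fun β => ∑ ρ, ∑ σ, D σ ((A ^ p) ρ β) * (A ^ q) σ ρ) A μ +
        (A ^ (p + q) * adMatrix c μ).trace := by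
    intro p μ
    have h₁ : Matrix.vecMul (fun β => ∑ ρ, ∑ σ, D σ ((A ^ p) ρ β) * (A ^ q) σ ρ) A μ =
        ∑ ρ, ∑ σ, ∑ β, D σ ((A ^ p) ρ β) * (A ^ q) σ ρ * A β μ := by
      simp only [Matrix.vecMul, dotProduct, sum_mul]
      rw [sum_comm]
      exact sum_congr rfl fun ρ _ => sum_comm
    have h₂ : (A ^ (p + q) * adMatrix c μ).trace =
        ∑ ρ, ∑ σ, ∑ β, (A ^ q) σ ρ * ((A ^ p) ρ β * c β μ σ) := by
      rw [add_comm p q, pow_add, mul_assoc]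
      simp only [Matrix.trace, Matrix.diag, Matrix.mul_apply, adMatrix, Matrix.of_apply, mul_sum]
      exact sum_comm
    rw [h₁, h₂]
    simp only [← sum_add_distrib]
    refine sum_congr rfl fun ρ _ => sum_congr rfl fun σ _ => ?_
    rw [pow_succ, Matrix.mul_apply, map_sum, sum_mul]
    refine sum_congr rfl fun β _ => ?_
    rw [Derivation.leibniz, hD, smul_eq_mul, smul_eq_mul]
    ring
  induction p generalizing μ with
  | zero =>
    have h : (fun β => ∑ ρ, ∑ σ, D σ ((A ^ 0) ρ β) * (A ^ q) σ ρ) = 0 := by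
      ext β
      refine sum_eq_zero fun ρ _ => sum_eq_zero fun σ _ => ?_
      rw [pow_zero, Matrix.one_apply]
      split_ifs <;> simp
    rw [step, h, Matrix.zero_vecMul, Pi.zero_apply, zero_add]
  | succ p ih =>
    rw [step, funext ih, vecMul_trace_pow_mul_adMatrix hanti hjac hA, Pi.zero_apply, zero_add]

end StructureConstants

/-- The degree `m + 1` coefficient of `(exp (-t) - 1) * (-t / (exp (-t) - 1)) = -t`. -/
theorem sum_antidiagonal_exp_mul_bernoulli (m : ℕ) :
    ∑ pq ∈ antidiagonal m, ((-1 : ℚ) ^ (pq.1 + 1) / (pq.1 + 1).factorial) *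
      ((-1) ^ pq.2 * bernoulli pq.2 / pq.2.factorial) = if m = 0 then -1 else 0 := by
  have h := sum_bernoulli (m + 1)
  rw [← Nat.sum_antidiagonal_eq_sum_range_succ_mk
    (fun pq : ℕ × ℕ => ((m + 1).choose pq.1 : ℚ) * bernoulli pq.1),
    ← Nat.sum_antidiagonal_swap] at h
  have hterm : ∀ pq ∈ antidiagonal m, ((-1 : ℚ) ^ (pq.1 + 1) / (pq.1 + 1).factorial) *
      ((-1) ^ pq.2 * bernoulli pq.2 / pq.2.factorial) =
      (-1) ^ (m + 1) / (m + 1).factorial * (((m + 1).choose pq.2 : ℚ) * bernoulli pq.2) := by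
    intro pq hpq
    obtain rfl := mem_antidiagonal.mp hpq
    have hc : (((pq.1 + pq.2 + 1).choose pq.2 : ℕ) : ℚ) =
        (pq.1 + pq.2 + 1).factorial / (pq.2.factorial * (pq.1 + 1).factorial) := by
      rw [Nat.cast_choose ℚ (by omega), show pq.1 + pq.2 + 1 - pq.2 = pq.1 + 1 by omega]
    rw [hc]
    have h₀ := Nat.factorial_ne_zero
    field_simp
    ring
  rw [sum_congr rfl hterm, ← mul_sum]
  simp only [Prod.fst_swap] at h
  rw [h]
  rcases m with - | m <;> simp

/-- Homogeneous components of `∑_{ρ,σ} (δ_σ (e^{−𝒞})^ρ_μ) φ^σ_ρ = −∑_λ C^λ_{μλ}`,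
where `e^{−𝒞} = ∑_p ((−1)^p/p!) 𝒞^p` and `φ = ∑_p ((−1)^p B_p/p!) 𝒞^p`:
the degree-`N` component (for `N ≥ 1`) equals `−∑_λ C^λ_{μλ}` when `N = 1` and `0`
when `N ≥ 2`.  This encodes the antipode formula `S(x̂_μ) = ŷ_μ − C^λ_{μλ}`. -/
theorem statement12 (k : Type*) [Field k] [CharZero k] (n : ℕ)
    (C : Fin n → Fin n → Fin n → k)
    (hanti : ∀ l μ ν, C l μ ν = - C l ν μ)
    (hjac : ∀ μ ν τ σ, ∑ ρ, (C ρ μ ν * C σ ρ τ + C ρ ν τ * C σ ρ μ + C ρ τ μ * C σ ρ ν) = 0)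
    (𝒞 : Matrix (Fin n) (Fin n) (MvPolynomial (Fin n) k))
    (h𝒞 : ∀ α β, 𝒞 α β = ∑ g, MvPolynomial.C (C α β g) * X g)
    (N : ℕ) (hN : 1 ≤ N) (μ : Fin n) :
    (N = 1 →
      ∑ pq ∈ antidiagonal N,
          MvPolynomial.C ((((-1) ^ pq.1 / pq.1.factorial) *
              ((-1) ^ pq.2 * bernoulli pq.2 / pq.2.factorial) : ℚ) : k) *
            ∑ ρ, ∑ σ, pderiv σ ((𝒞 ^ pq.1) ρ μ) * (𝒞 ^ pq.2) σ ρ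
        = MvPolynomial.C (- ∑ l, C l μ l)) ∧
    (2 ≤ N →
      ∑ pq ∈ antidiagonal N,
          MvPolynomial.C ((((-1) ^ pq.1 / pq.1.factorial) *
              ((-1) ^ pq.2 * bernoulli pq.2 / pq.2.factorial) : ℚ) : k) *
            ∑ ρ, ∑ σ, pderiv σ ((𝒞 ^ pq.1) ρ μ) * (𝒞 ^ pq.2) σ ρ
        = 0) := by
  have hanti' : ∀ l μ ν, (MvPolynomial.C (C l μ ν) : MvPolynomial (Fin n) k) =
      - MvPolynomial.C (C l ν μ) := fun l μ ν => by rw [hanti l μ ν, map_neg]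
  have hjac' : ∀ μ ν τ σ, ∑ ρ, ((MvPolynomial.C (C ρ μ ν) : MvPolynomial (Fin n) k) *
      MvPolynomial.C (C σ ρ τ) + MvPolynomial.C (C ρ ν τ) * MvPolynomial.C (C σ ρ μ) +
      MvPolynomial.C (C ρ τ μ) * MvPolynomial.C (C σ ρ ν)) = 0 := fun μ ν τ σ => by
    simp only [← map_mul, ← map_add, ← map_sum, hjac, map_zero]
  have hD : ∀ σ α β, pderiv σ (𝒞 α β) = MvPolynomial.C (C α β σ) := fun σ α β => by
    simp [h𝒞, pderiv_X, Pi.single_apply]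
  have main : ∀ m, ∑ pq ∈ antidiagonal (m + 1),
      MvPolynomial.C ((((-1) ^ pq.1 / pq.1.factorial) *
          ((-1) ^ pq.2 * bernoulli pq.2 / pq.2.factorial) : ℚ) : k) *
        ∑ ρ, ∑ σ, pderiv σ ((𝒞 ^ pq.1) ρ μ) * (𝒞 ^ pq.2) σ ρ =
      MvPolynomial.C (((if m = 0 then -1 else 0 : ℚ)) : k) *
        (𝒞 ^ m * adMatrix (fun l μ ν => MvPolynomial.C (C l μ ν)) μ).trace := by
    intro m
    have h₀ : ∑ ρ, ∑ σ, pderiv σ ((𝒞 ^ 0) ρ μ) * (𝒞 ^ (m + 1)) σ ρ = 0 := by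
      refine sum_eq_zero fun ρ _ => sum_eq_zero fun σ _ => ?_
      rw [pow_zero, Matrix.one_apply]
      split_ifs <;> simp
    rw [Nat.antidiagonal_succ, sum_cons, h₀, mul_zero, zero_add, sum_map,
      ← sum_antidiagonal_exp_mul_bernoulli, Rat.cast_sum, map_sum, sum_mul]
    refine sum_congr rfl fun pq hpq => ?_
    rw [← mem_antidiagonal.mp hpq,
      ← sum_derivation_pow_mul_pow (fun σ => pderiv σ) hanti' hjac' h𝒞 hD]
    rfl
  obtain ⟨m, rfl⟩ := Nat.exists_eq_add_of_le' hN
  rw [main]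
  refine ⟨fun h => ?_, fun h => ?_⟩
  · obtain rfl : m = 0 := by omega
    simp [adMatrix, Matrix.trace]
  · rw [if_neg (by omega)]
    simp
end
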